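/- For a convex body K in ℝ^n and the unit ball D, the function ε ↦ vol(K + εD), for ε ≥ 0, is a polynomial in ε of degree at most n (the Steiner polynomial). -/

import Mathlib

open MeasureTheory Metric Pointwise
open scoped RealInnerProductSpace

section NearestPoint

variable {E : Type*} [NormedAddCommGroup E] [InnerProductSpace ℝ E]

/-- `p` is the nearest-point map onto `K`, expressed through the obtuse-angle criterion. -/
def IsNearestPointMap (K : Set E) (p : E → E) : Prop :=
  ∀ x, p x ∈ K ∧ ∀ w ∈ K, ⟪x - p x, w - p x⟫ ≤ 0

theorem exists_isNearestPointMap {K : Set E} (hne : K.Nonempty) (hcomp : IsComplete K)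
    (hconv : Convex ℝ K) : ∃ p : E → E, IsNearestPointMap K p := by
  have h (x : E) : ∃ v ∈ K, ∀ w ∈ K, ⟪x - v, w - v⟫ ≤ 0 := by
    obtain ⟨v, hv, hxv⟩ := exists_norm_eq_iInf_of_complete_convex hne hcomp hconv x
    exact ⟨v, hv, (norm_eq_iInf_iff_real_inner_le_zero hconv hv).1 hxv⟩
  choose p hp using h
  exact ⟨p, hp⟩

namespace IsNearestPointMap

variable {K : Set E} {p : E → E}

theorem norm_sq_le_inner (hp : IsNearestPointMap K p) (x y : E) :
    ‖p x - p y‖ ^ 2 ≤ ⟪p x - p y, x - y⟫ := by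
  have h₁ := (hp x).2 (p y) (hp y).1
  have h₂ := (hp y).2 (p x) (hp x).1
  have h₃ : ⟪p x - p y, x - y⟫ =
      ‖p x - p y‖ ^ 2 - ⟪x - p x, p y - p x⟫ - ⟪y - p y, p x - p y⟫ := by
    rw [← real_inner_self_eq_norm_sq, real_inner_comm]
    simp only [inner_sub_left, inner_sub_right, real_inner_comm]
    simp only [real_inner_comm (p y) (p x)]
    ring
  linarith

theorem lipschitzWith_one (hp : IsNearestPointMap K p) : LipschitzWith 1 p := by
  refine LipschitzWith.of_dist_le_mul fun x y => ?_
  have h := (hp.norm_sq_le_inner x y).trans (real_inner_le_norm _ _)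
  rw [NNReal.coe_one, one_mul, dist_eq_norm, dist_eq_norm]
  by_contra! hlt
  nlinarith [norm_nonneg (x - y)]

theorem eq_of_forall_inner_nonpos (hp : IsNearestPointMap K p) {x v : E} (hv : v ∈ K)
    (h : ∀ w ∈ K, ⟪x - v, w - v⟫ ≤ 0) : p x = v := by
  have h₁ := (hp x).2 v hv
  have h₂ := h (p x) (hp x).1
  have h₃ : ‖p x - v‖ ^ 2 = ⟪x - v, p x - v⟫ + ⟪x - p x, v - p x⟫ := by
    rw [← real_inner_self_eq_norm_sq, ← neg_sub (p x) v, inner_neg_right, ← sub_eq_add_neg,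
      ← inner_sub_left]
    congr 1
    abel
  have h₄ : ‖p x - v‖ ^ 2 ≤ 0 := by linarith
  exact sub_eq_zero.1 (norm_eq_zero.1 (pow_eq_zero_iff two_ne_zero |>.1
    (le_antisymm h₄ (sq_nonneg _))))

theorem infDist_eq (hp : IsNearestPointMap K p) (x : E) : infDist x K = ‖x - p x‖ := by
  refine le_antisymm ((infDist_le_dist_of_mem (hp x).1).trans_eq (dist_eq_norm _ _)) ?_
  rw [le_infDist ⟨_, (hp x).1⟩]
  intro w hw
  have h := (hp x).2 w hw
  have h₁ : ‖x - w‖ ^ 2 = ‖x - p x‖ ^ 2 - 2 * ⟪x - p x, w - p x⟫ + ‖w - p x‖ ^ 2 := by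
    rw [← norm_sub_sq_real, sub_sub_sub_cancel_right]
  rw [dist_eq_norm]
  refine le_of_sq_le_sq ?_ (norm_nonneg _)
  nlinarith [sq_nonneg ‖w - p x‖]

end IsNearestPointMap

/-- Scaling by `s` along the segments that join points to their images under `p`. -/
def scaleFrom (p : E → E) (s : ℝ) (x : E) : E :=
  p x + s • (x - p x)

namespace IsNearestPointMap

variable {K : Set E} {p : E → E}

theorem apply_scaleFrom (hp : IsNearestPointMap K p) {s : ℝ} (hs : 0 ≤ s) (x : E) :
    p (scaleFrom p s x) = p x := by
  refine hp.eq_of_forall_inner_nonpos (hp x).1 fun w hw => ?_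
  rw [scaleFrom, add_sub_cancel_left, real_inner_smul_left]
  exact mul_nonpos_of_nonneg_of_nonpos hs ((hp x).2 w hw)

theorem scaleFrom_scaleFrom (hp : IsNearestPointMap K p) {t : ℝ} (ht : 0 ≤ t) (s : ℝ) (x : E) :
    scaleFrom p s (scaleFrom p t x) = scaleFrom p (s * t) x := by
  rw [scaleFrom, hp.apply_scaleFrom ht, scaleFrom, scaleFrom, add_sub_cancel_left, smul_smul]

theorem infDist_scaleFrom (hp : IsNearestPointMap K p) {s : ℝ} (hs : 0 ≤ s) (x : E) :
    infDist (scaleFrom p s x) K = s * infDist x K := by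
  rw [hp.infDist_eq, hp.apply_scaleFrom hs, hp.infDist_eq, scaleFrom, add_sub_cancel_left,
    norm_smul, Real.norm_of_nonneg hs]

theorem scaleFrom_inv_scaleFrom (hp : IsNearestPointMap K p) {s : ℝ} (hs : 0 < s) (x : E) :
    scaleFrom p s⁻¹ (scaleFrom p s x) = x := by
  rw [hp.scaleFrom_scaleFrom hs.le, inv_mul_cancel₀ hs.ne', scaleFrom, one_smul,
    add_sub_cancel]

theorem injective_scaleFrom (hp : IsNearestPointMap K p) {s : ℝ} (hs : 0 < s) :
    Function.Injective (scaleFrom p s) :=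
  Function.LeftInverse.injective (hp.scaleFrom_inv_scaleFrom hs)

theorem image_scaleFrom_cthickening (hp : IsNearestPointMap K p) {s : ℝ} (hs : 0 < s) :
    scaleFrom p s '' cthickening 1 K = cthickening s K := by
  have hmem {r : ℝ} (hr : 0 ≤ r) (x : E) : x ∈ cthickening r K ↔ infDist x K ≤ r := by
    rw [cthickening_eq_preimage_infEDist, Set.mem_preimage, Set.mem_Iic, infDist,
      ENNReal.le_ofReal_iff_toReal_le (infEDist_ne_top ⟨_, (hp x).1⟩) hr]
  ext y
  constructor
  · rintro ⟨x, hx, rfl⟩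
    rw [hmem zero_le_one] at hx
    rw [hmem hs.le, hp.infDist_scaleFrom hs.le]
    nlinarith
  · intro hy
    refine ⟨scaleFrom p s⁻¹ y, ?_, ?_⟩
    · rw [hmem hs.le] at hy
      rw [hmem zero_le_one, hp.infDist_scaleFrom (inv_nonneg.2 hs.le), inv_mul_le_one₀ hs]
      exact hy
    · simpa using hp.scaleFrom_inv_scaleFrom (inv_pos.2 hs) y

theorem exists_lipschitzWith_scaleFrom (hp : IsNearestPointMap K p) (s : ℝ) :
    ∃ C, LipschitzWith C (scaleFrom p s) :=
  ⟨_, hp.lipschitzWith_one.add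
    ((lipschitzWith_smul s).comp (LipschitzWith.id.sub hp.lipschitzWith_one))⟩

theorem inner_fderiv_nonneg (hp : IsNearestPointMap K p) {x : E} (hx : DifferentiableAt ℝ p x)
    (v : E) : 0 ≤ ⟪fderiv ℝ p x v, v⟫ := by
  have hmono : Monotone fun t : ℝ => ⟪p (x + t • v), v⟫ := by
    intro a b hab
    rcases hab.eq_or_lt with rfl | hab
    · exact le_rfl
    have h := (sq_nonneg _).trans (hp.norm_sq_le_inner (x + b • v) (x + a • v))
    rw [add_sub_add_left_eq_sub, ← sub_smul, real_inner_smul_right] at h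
    have h' := nonneg_of_mul_nonneg_right h (sub_pos.2 hab)
    rw [inner_sub_left] at h'
    exact sub_nonneg.1 h'
  have hd : HasDerivAt (fun t : ℝ => ⟪p (x + t • v), v⟫) ⟪fderiv ℝ p x v, v⟫ 0 := by
    have h : HasDerivAt (fun t : ℝ => p (x + t • v)) (fderiv ℝ p x v) 0 :=
      hx.hasFDerivAt.hasLineDerivAt v
    simpa using h.inner ℝ (hasDerivAt_const 0 v)
  rw [← hd.deriv]
  exact hmono.deriv_nonneg

theorem inner_fderiv_le (hp : IsNearestPointMap K p) (x v : E) :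
    ⟪fderiv ℝ p x v, v⟫ ≤ ‖v‖ ^ 2 := by
  have h : ‖fderiv ℝ p x‖ ≤ 1 := norm_fderiv_le_of_lipschitz ℝ hp.lipschitzWith_one
  calc ⟪fderiv ℝ p x v, v⟫ ≤ ‖fderiv ℝ p x v‖ * ‖v‖ := real_inner_le_norm _ _
    _ ≤ ‖v‖ * ‖v‖ := by
      gcongr
      simpa using (fderiv ℝ p x).le_of_opNorm_le h v
    _ = ‖v‖ ^ 2 := (sq _).symm

end IsNearestPointMap

end NearestPoint

section Determinant

open Polynomial in
theorem exists_polynomial_eval_eq_det {E : Type*} [AddCommGroup E] [Module ℝ E]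
    [FiniteDimensional ℝ E] (A B : E →ₗ[ℝ] E) :
    ∃ P : ℝ[X], P.natDegree ≤ Module.finrank ℝ E ∧
      ∀ s : ℝ, P.eval s = LinearMap.det (A + s • B) := by
  let b := Module.finBasis ℝ E
  let M := LinearMap.toMatrix b b
  refine ⟨Matrix.det ((X : ℝ[X]) • (M B).map C + (M A).map C), ?_, fun s => ?_⟩
  · simpa using natDegree_det_X_add_C_le (M B) (M A)
  · rw [← LinearMap.det_toMatrix b, ← coe_evalRingHom, RingHom.map_det]
    congr 1
    ext i j
    simp [M, add_comm, mul_comm s]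

/-- The operators on the ray from `A` through the identity have positive quadratic form and hence
positive determinant. -/
theorem det_add_smul_id_sub_pos {E : Type*} [NormedAddCommGroup E] [InnerProductSpace ℝ E]
    [FiniteDimensional ℝ E] {A : E →L[ℝ] E} (h₀ : ∀ v, 0 ≤ ⟪A v, v⟫)
    (h₁ : ∀ v, ⟪A v, v⟫ ≤ ‖v‖ ^ 2) {s : ℝ} (hs : 0 < s) :
    0 < (A + s • (ContinuousLinearMap.id ℝ E - A)).det := by
  let B (t : ℝ) : E →L[ℝ] E := A + t • (ContinuousLinearMap.id ℝ E - A)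
  obtain ⟨P, -, hP⟩ := exists_polynomial_eval_eq_det (A : E →ₗ[ℝ] E)
    (LinearMap.id - (A : E →ₗ[ℝ] E))
  have hPB (t : ℝ) : P.eval t = (B t).det := hP t
  have hne (t : ℝ) (ht : 0 < t) : P.eval t ≠ 0 := by
    intro h
    rw [hP] at h
    obtain ⟨v, hv, hv0⟩ := Submodule.exists_mem_ne_zero_of_ne_bot
      (LinearMap.bot_lt_ker_of_det_eq_zero h).ne'
    have hv' : A v + t • (v - A v) = 0 := by simpa using hv
    have hin : ⟪A v + t • (v - A v), v⟫ = 0 := by rw [hv', inner_zero_left]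
    rw [inner_add_left, real_inner_smul_left, inner_sub_left, real_inner_self_eq_norm_sq] at hin
    have hpos : 0 < ‖v‖ ^ 2 := by positivity
    rcases le_total t 1 with h1 | h1
    · nlinarith [h₀ v, mul_pos ht hpos, mul_nonneg (sub_nonneg.2 h1) (h₀ v)]
    · nlinarith [h₁ v, mul_nonneg (sub_nonneg.2 h1) (sub_nonneg.2 (h₁ v))]
  have h1 : P.eval 1 = 1 := by simp [hP]
  change 0 < (B s).det
  rw [← hPB]
  by_contra! hle
  obtain ⟨t, ht, ht0⟩ := (isPreconnected_Ioi (a := (0 : ℝ))).intermediate_value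
    (Set.mem_Ioi.2 hs) (Set.mem_Ioi.2 one_pos) P.continuous.continuousOn
    (show (0 : ℝ) ∈ Set.Icc (P.eval s) (P.eval 1) from ⟨hle, h1.symm ▸ zero_le_one⟩)
  exact hne t ht ht0

end Determinant

section Volume

variable {E : Type*} [NormedAddCommGroup E] [InnerProductSpace ℝ E] [FiniteDimensional ℝ E]
  [MeasurableSpace E] [BorelSpace E]

theorem LipschitzWith.addHaar_image_eq_zero {C : NNReal} {f : E → E} (hf : LipschitzWith C f)
    (μ : Measure E) [μ.IsAddHaarMeasure] {s : Set E} (hs : μ s = 0) : μ (f '' s) = 0 := by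
  let ν : Measure E := μH[Module.finrank ℝ E]
  have hμν : μ ≪ ν := Measure.absolutelyContinuous_isAddHaarMeasure μ ν
  have hνμ : ν ≪ μ := Measure.absolutelyContinuous_isAddHaarMeasure ν μ
  refine hμν (le_antisymm ?_ zero_le)
  calc ν (f '' s) ≤ (C : ENNReal) ^ (Module.finrank ℝ E : ℝ) * ν s :=
        hf.hausdorffMeasure_image_le (Nat.cast_nonneg _) s
    _ = 0 := by rw [hνμ hs, mul_zero]

/-- If `F s x` is, for each `x`, a polynomial in `s` of degree at most `n`, then so is
`∫ x, F s x ∂μ`. -/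
theorem exists_polynomial_eval_eq_integral {α : Type*} [MeasurableSpace α] {μ : Measure α}
    {F : ℝ → α → ℝ} {n : ℕ} (hF : ∀ s, 0 < s → Integrable (F s) μ)
    (hP : ∀ᵐ x ∂μ, ∃ P : Polynomial ℝ, P.natDegree ≤ n ∧ ∀ s, 0 < s → P.eval s = F s x) :
    ∃ Q : Polynomial ℝ, Q.natDegree ≤ n ∧ ∀ s, 0 < s → Q.eval s = ∫ x, F s x ∂μ := by
  let v (i : ℕ) : ℝ := i + 1
  let S := Finset.range (n + 1)
  have hv : Set.InjOn v S := fun i _ j _ h => by simpa [v] using h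
  have hvpos (i : ℕ) : 0 < v i := by positivity
  refine ⟨Lagrange.interpolate S v fun i => ∫ x, F (v i) x ∂μ, ?_, fun s hs => ?_⟩
  · have h := Lagrange.degree_interpolate_lt (fun i => ∫ x, F (v i) x ∂μ) hv
    rw [Finset.card_range] at h
    exact Polynomial.natDegree_le_iff_coeff_eq_zero.2 fun m hm =>
      Polynomial.degree_lt_iff_coeff_zero _ _ |>.1 h m hm
  · have hlag : ∀ᵐ x ∂μ, F s x = ∑ i ∈ S, F (v i) x * (Lagrange.basis S v i).eval s := by
      filter_upwards [hP] with x ⟨P, hPn, hPF⟩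
      have hdeg : P.degree < S.card := by
        rw [Finset.card_range]
        exact (Polynomial.degree_le_of_natDegree_le hPn).trans_lt (by exact_mod_cast n.lt_succ_self)
      rw [← hPF s hs, Lagrange.eq_interpolate hv hdeg]
      simp [Lagrange.interpolate_apply, Polynomial.eval_finsetSum, hPF _ (hvpos _)]
    rw [integral_congr_ae hlag,
      integral_finsetSum _ fun i _ => (hF _ (hvpos i)).mul_const _]
    simp [Lagrange.interpolate_apply, Polynomial.eval_finsetSum, integral_mul_const]

theorem exists_polynomial_eval_eq_addHaar_cthickening (μ : Measure E) [μ.IsAddHaarMeasure]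
    {K : Set E} (hKc : IsCompact K) (hK : Convex ℝ K) (hKn : K.Nonempty) :
    ∃ Q : Polynomial ℝ, Q.natDegree ≤ Module.finrank ℝ E ∧
      ∀ s, 0 ≤ s → Q.eval s = μ.real (cthickening s K) := by
  obtain ⟨p, hp⟩ := exists_isNearestPointMap hKn hKc.isComplete hK
  let A (x : E) : E →L[ℝ] E := fderiv ℝ p x
  let B (s : ℝ) (x : E) : E →L[ℝ] E := A x + s • (ContinuousLinearMap.id ℝ E - A x)
  let N : Set E := {x | ¬ DifferentiableAt ℝ p x}
  let S : Set E := cthickening 1 K ∩ {x | DifferentiableAt ℝ p x}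
  have hN : μ N = 0 := hp.lipschitzWith_one.ae_differentiableAt
  have hS : MeasurableSet S :=
    isClosed_cthickening.measurableSet.inter (measurableSet_of_differentiableAt ℝ p)
  have hder (s : ℝ) : ∀ x ∈ S, HasFDerivWithinAt (scaleFrom p s) (B s x) S x := fun x hx =>
    (hx.2.hasFDerivAt.add (((hasFDerivAt_id x).sub hx.2.hasFDerivAt).const_smul s)).hasFDerivWithinAt
  have hpos {s : ℝ} (hs : 0 < s) (x : E) (hx : x ∈ S) : 0 < (B s x).det :=
    det_add_smul_id_sub_pos (hp.inner_fderiv_nonneg hx.2) (hp.inner_fderiv_le x) hs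
  have hvol {s : ℝ} (hs : 0 < s) : μ (scaleFrom p s '' S) = μ (cthickening s K) := by
    obtain ⟨C, hC⟩ := hp.exists_lipschitzWith_scaleFrom s
    rw [← hp.image_scaleFrom_cthickening hs]
    refine le_antisymm (measure_mono (Set.image_mono Set.inter_subset_left)) ?_
    have hsub : scaleFrom p s '' cthickening 1 K ⊆ scaleFrom p s '' S ∪ scaleFrom p s '' N := by
      rw [← Set.image_union]
      refine Set.image_mono fun x hx => ?_
      by_cases h : DifferentiableAt ℝ p x
      · exact Or.inl ⟨hx, h⟩
      · exact Or.inr h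
    calc _ ≤ _ := measure_mono hsub
      _ ≤ _ := measure_union_le _ _
      _ = _ := by rw [hC.addHaar_image_eq_zero μ hN, add_zero]
  have habs {s : ℝ} (hs : 0 < s) :
      Set.EqOn (fun x => |(B s x).det| • (1 : ℝ)) (fun x => (B s x).det) S := fun x hx => by
    simp [abs_of_pos (hpos hs x hx)]
  have hinteg {s : ℝ} (hs : 0 < s) : IntegrableOn (fun x => (B s x).det) S μ := by
    rw [← integrableOn_congr_fun (habs hs) hS,
      ← integrableOn_image_iff_integrableOn_abs_det_fderiv_smul μ hS (hder s)
        (hp.injective_scaleFrom hs).injOn fun _ => (1 : ℝ)]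
    refine integrableOn_const ?_
    rw [hvol hs]
    exact hKc.isBounded.cthickening.measure_lt_top.ne
  obtain ⟨Q, hQn, hQ⟩ := exists_polynomial_eval_eq_integral
    (μ := μ.restrict S) (F := fun s x => (B s x).det) (fun s hs => hinteg hs)
    (.of_forall fun x =>
      let ⟨P, hPn, hP⟩ := exists_polynomial_eval_eq_det (A x : E →ₗ[ℝ] E)
        (LinearMap.id - (A x : E →ₗ[ℝ] E))
      ⟨P, hPn, fun s _ => hP s⟩)
  have hQpos (s : ℝ) (hs : 0 < s) : Q.eval s = μ.real (cthickening s K) := by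
    rw [hQ s hs, ← setIntegral_congr_fun hS (habs hs),
      ← integral_image_eq_integral_abs_det_fderiv_smul μ hS (hder s)
        (hp.injective_scaleFrom hs).injOn fun _ => (1 : ℝ)]
    simp [Measure.real, hvol hs]
  refine ⟨Q, hQn, fun s hs => ?_⟩
  rcases hs.eq_or_lt with rfl | hs
  · have hlim : Filter.Tendsto (fun s => μ.real (cthickening s K)) (nhdsWithin 0 (Set.Ioi 0))
        (nhds (μ.real (cthickening 0 K))) := by
      rw [cthickening_zero, hKc.isClosed.closure_eq]
      exact ((ENNReal.tendsto_toReal hKc.measure_lt_top.ne).comp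
        (tendsto_measure_cthickening_of_isCompact hKc)).mono_left nhdsWithin_le_nhds
    refine tendsto_nhds_unique
      ((Q.continuous.tendsto 0).mono_left nhdsWithin_le_nhds) (hlim.congr' ?_)
    filter_upwards [self_mem_nhdsWithin] with s hs using (hQpos s hs).symm
  · exact hQpos s hs

end Volume

/-- Steiner polynomial: for a convex body `K` in ℝⁿ and the closed unit ball `D`,
the function `ε ↦ vol (K + ε • D)`, `ε ≥ 0`, is a polynomial in `ε` of degree at most `n`. -/
theorem steiner_polynomial (n : ℕ)
    (K : Set (EuclideanSpace ℝ (Fin n)))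
    (hKc : IsCompact K) (hK : Convex ℝ K) (hKn : K.Nonempty) :
    ∃ c : Fin (n + 1) → ℝ, ∀ ε : ℝ, 0 ≤ ε →
      (volume (K + ε • closedBall (0 : EuclideanSpace ℝ (Fin n)) 1)).toReal
        = ∑ i : Fin (n + 1), c i * ε ^ (i : ℕ) := by
  obtain ⟨Q, hQn, hQ⟩ := exists_polynomial_eval_eq_addHaar_cthickening volume hKc hK hKn
  rw [finrank_euclideanSpace_fin] at hQn
  refine ⟨fun i => Q.coeff i, fun ε hε => ?_⟩
  rw [smul_unitClosedBall_of_nonneg hε, hKc.add_closedBall_zero hε, Fin.sum_univ_eq_sum_range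
    (fun i => Q.coeff i * ε ^ i), ← Polynomial.eval_eq_sum_range' (Nat.lt_succ_of_le hQn), hQ ε hε]
  rfl
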